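/- arXiv:math/0610347 — 2 statements merged into one kernel-verified Lean document; each statement's English description precedes it below -/
import Mathlib

section
/- Let L be a finite-dimensional 2-soluble n-Lie algebra and let A be a minimal abelian embedded ideal of L with C_L(A) = A. Let U be a complement to A in L (a subalgebra with U + A = L and U ∩ A = 0). Then for every nonzero u ∈ U there exists an A-inner automorphism θ of L such that u ∉ θ(U); in particular, the intersection of all complements to A in L is zero. -/
namespace NLie

open Finset

variable {F : Type*} [Field F] {L : Type*} [AddCommGroup L] [Module F L] {n : ℕ}

/-- The generalized Jacobi identity for an `(n+2)`-ary alternating bracket: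
`[y₁,…,y_{n+1},[x₁,…,x_{n+2}]] = ∑ᵢ [x₁,…,[y₁,…,y_{n+1},xᵢ],…,x_{n+2}]`.
(This is the identity (1) of the paper, rewritten with the string `y` in the
first `n+1` slots, which is equivalent since the bracket is alternating.) -/
def IsNLie (f : AlternatingMap F L L (Fin (n + 2))) : Prop :=
  ∀ (y : Fin (n + 1) → L) (x : Fin (n + 2) → L),
    f (Fin.snoc y (f x)) = ∑ i, f (Function.update x i (f (Fin.snoc y (x i))))

/-- `d : L → L` is a derivation of the bracket `f`. -/
def IsDerivation (f : AlternatingMap F L L (Fin (n + 2))) (d : L →ₗ[F] L) : Prop :=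
  ∀ x : Fin (n + 2) → L, d (f x) = ∑ i, f (Function.update x i (d (x i)))

/-- The (inner) derivation `D(a₁,…,a_{n+1}) : x ↦ [a₁,…,a_{n+1},x]`. -/
def D (f : AlternatingMap F L L (Fin (n + 2))) (a : Fin (n + 1) → L) : L →ₗ[F] L where
  toFun x := f (Fin.snoc a x)
  map_add' x y := by
    have h := f.toMultilinearMap.map_update_add (Fin.snoc a x) (Fin.last (n + 1)) x y
    simpa [Fin.update_snoc_last] using h
  map_smul' c x := by
    have h := f.toMultilinearMap.map_update_smul (Fin.snoc a x) (Fin.last (n + 1)) c x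
    simpa [Fin.update_snoc_last] using h

/-- `D(U)`: the span of all inner derivations `D(a₁,…,a_{n+1})` with all `aᵢ ∈ U`. -/
def Dspan (f : AlternatingMap F L L (Fin (n + 2))) (U : Submodule F L) :
    Submodule F (L →ₗ[F] L) :=
  Submodule.span F {d | ∃ a : Fin (n + 1) → L, (∀ i, a i ∈ U) ∧ d = D f a}

/-- The Engel subspace `E_L(d) = {x ∈ L ∣ dʳ x = 0 for some r}`. -/
def engel (d : L →ₗ[F] L) : Submodule F L where
  carrier := {x | ∃ r, (d ^ r) x = 0}
  zero_mem' := ⟨0, map_zero _⟩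
  add_mem' := by
    rintro a b ⟨r, hr⟩ ⟨s, hs⟩
    refine ⟨r + s, ?_⟩
    have h1 : (d ^ (r + s)) a = (d ^ s) ((d ^ r) a) := by
      rw [add_comm r s, pow_add]; rfl
    have h2 : (d ^ (r + s)) b = (d ^ r) ((d ^ s) b) := by
      rw [pow_add]; rfl
    rw [map_add, h1, h2, hr, hs, map_zero, map_zero, add_zero]
  smul_mem' := by
    rintro c a ⟨r, hr⟩
    exact ⟨r, by rw [map_smul, hr, smul_zero]⟩

/-- `E` is an Engel subalgebra of `L`: `E = E_L(d)` for some inner derivation `d ∈ D(E)`. -/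
def IsEngel (f : AlternatingMap F L L (Fin (n + 2))) (E : Submodule F L) : Prop :=
  ∃ d : L →ₗ[F] L, d ∈ Dspan f E ∧ E = engel d

/-- `[A₁,…,A_{n+2}]`: the subspace spanned by all brackets with `aᵢ ∈ Aᵢ`. -/
def bracketSpan (f : AlternatingMap F L L (Fin (n + 2))) (A : Fin (n + 2) → Submodule F L) :
    Submodule F L :=
  Submodule.span F {z | ∃ a : Fin (n + 2) → L, (∀ i, a i ∈ A i) ∧ f a = z}

/-- `K` is a subalgebra of `L`. -/
def IsSubalg (f : AlternatingMap F L L (Fin (n + 2))) (K : Submodule F L) : Prop :=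
  ∀ a : Fin (n + 2) → L, (∀ i, a i ∈ K) → f a ∈ K

/-- `K` is an ideal of `L` : `[K,L,…,L] ⊆ K`. -/
def IsIdeal (f : AlternatingMap F L L (Fin (n + 2))) (K : Submodule F L) : Prop :=
  ∀ a : Fin (n + 2) → L, a 0 ∈ K → f a ∈ K

/-- `V` is an ideal of the subalgebra `W`. -/
def IsIdealIn (f : AlternatingMap F L L (Fin (n + 2))) (V W : Submodule F L) : Prop :=
  V ≤ W ∧ ∀ a : Fin (n + 2) → L, a 0 ∈ V → (∀ i, a i ∈ W) → f a ∈ V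

/-- `M` is a maximal proper subalgebra of `L`. -/
def IsMaximalSubalg (f : AlternatingMap F L L (Fin (n + 2))) (M : Submodule F L) : Prop :=
  IsSubalg f M ∧ M ≠ ⊤ ∧ ∀ U : Submodule F L, IsSubalg f U → M < U → U = ⊤

/-- The Frattini subalgebra: the intersection of all maximal proper subalgebras. -/
def frattini (f : AlternatingMap F L L (Fin (n + 2))) : Submodule F L :=
  sInf {M | IsMaximalSubalg f M}

/-- The lower central series of a subalgebra `U`:
`U¹ = U`, `U^{s+1} = [Uˢ, U,…,U]`. (`lcsIn f U s` is `U^{s+1}`.) -/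
def lcsIn (f : AlternatingMap F L L (Fin (n + 2))) (U : Submodule F L) : ℕ → Submodule F L
  | 0 => U
  | s + 1 => bracketSpan f (Fin.cons (lcsIn f U s) fun _ => U)

/-- `L` is a nilpotent `(n+2)`-Lie algebra. -/
def IsNilpotentAlg (f : AlternatingMap F L L (Fin (n + 2))) : Prop :=
  ∃ r, lcsIn f ⊤ r = ⊥

/-- The lower central series of `U` modulo `K`: `U/K` is nilpotent iff some term
of this series is contained in `K`. -/
def lcsMod (f : AlternatingMap F L L (Fin (n + 2))) (U K : Submodule F L) : ℕ → Submodule F L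
  | 0 => U
  | s + 1 => bracketSpan f (Fin.cons (lcsMod f U K s) fun _ => U) ⊔ K

/-- The series `K¹ = K`, `K^{s+1} = [Kˢ, K, L,…,L]` used to define
"2-nilpotently embedded". -/
def nes2 (f : AlternatingMap F L L (Fin (n + 2))) (K : Submodule F L) : ℕ → Submodule F L
  | 0 => K
  | s + 1 => bracketSpan f (Fin.cons (nes2 f K s) (Fin.cons K fun _ => ⊤))

/-- The series of `B` modulo `A`, so that `B/A` is 2-nilpotently embedded in `L/A`
iff some term of this series is contained in `A`. -/
def nes2Mod (f : AlternatingMap F L L (Fin (n + 2))) (B A : Submodule F L) : ℕ → Submodule F L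
  | 0 => B
  | s + 1 => bracketSpan f (Fin.cons (nes2Mod f B A s) (Fin.cons B fun _ => ⊤)) ⊔ A

/-- The 2-derived series: `L⁽⁰⁾ = L`, `L⁽ˢ⁺¹⁾ = [L⁽ˢ⁾, L⁽ˢ⁾, L,…,L]`. -/
def ds2 (f : AlternatingMap F L L (Fin (n + 2))) : ℕ → Submodule F L
  | 0 => ⊤
  | s + 1 => bracketSpan f (Fin.cons (ds2 f s) (Fin.cons (ds2 f s) fun _ => ⊤))

/-- `L` is 2-soluble. -/
def Is2Soluble (f : AlternatingMap F L L (Fin (n + 2))) : Prop :=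
  ∃ r, ds2 f r = ⊥

/-- The `k`-derived series of an ideal `K`:
`K⁽⁰⁾ = K`, `K⁽ˢ⁺¹⁾ = [(k)K⁽ˢ⁾, (n+2-k)L]`: `K` is `k`-solubly embedded in `L`
iff some term vanishes. -/
def dsk (f : AlternatingMap F L L (Fin (n + 2))) (k : ℕ) (K : Submodule F L) :
    ℕ → Submodule F L
  | 0 => K
  | s + 1 => bracketSpan f (fun i => if (i : ℕ) < k then dsk f k K s else ⊤)

/-- The `k`-derived series of `A` modulo `B`: `A/B` is `k`-solubly embedded in `L/B`
iff some term of this series is contained in `B`. -/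
def dskMod (f : AlternatingMap F L L (Fin (n + 2))) (k : ℕ) (A B : Submodule F L) :
    ℕ → Submodule F L
  | 0 => A
  | s + 1 => bracketSpan f (fun i => if (i : ℕ) < k then dskMod f k A B s else ⊤) ⊔ B

/-- The ideal `A` is abelian embedded in `L`: `[A,A,L,…,L] = 0`. -/
def IsAbelianEmbedded (f : AlternatingMap F L L (Fin (n + 2))) (A : Submodule F L) : Prop :=
  ∀ a : Fin (n + 2) → L, a 0 ∈ A → a 1 ∈ A → f a = 0

/-- `A` is a minimal abelian embedded ideal of `L`: a nonzero abelian embedded ideal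
whose only properly contained ideal is `0`. -/
def IsMinAbelianEmbeddedIdeal (f : AlternatingMap F L L (Fin (n + 2)))
    (A : Submodule F L) : Prop :=
  A ≠ ⊥ ∧ IsIdeal f A ∧ IsAbelianEmbedded f A ∧
    ∀ B : Submodule F L, IsIdeal f B → B < A → B = ⊥

/-- The normalizer `N_L(U) = {x ∈ L ∣ [x,u₁,…,u_{n+1}] ∈ U for all uᵢ ∈ U}`. -/
def normalizer (f : AlternatingMap F L L (Fin (n + 2))) (U : Submodule F L) : Set L :=
  {x | ∀ u : Fin (n + 1) → L, (∀ i, u i ∈ U) → f (Fin.cons x u) ∈ U}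

/-- The centralizer `C_L(A) = {c ∈ L ∣ [c,a,x₃,…,x_{n+2}] = 0 for all a ∈ A, xᵢ ∈ L}`. -/
def centralizer (f : AlternatingMap F L L (Fin (n + 2))) (A : Submodule F L) : Set L :=
  {c | ∀ a ∈ A, ∀ x : Fin n → L, f (Fin.cons c (Fin.cons a x)) = 0}

/-- `S` is a Cartan subalgebra of `L`: a nilpotent self-normalizing subalgebra. -/
def IsCartan (f : AlternatingMap F L L (Fin (n + 2))) (S : Submodule F L) : Prop :=
  IsSubalg f S ∧ (∃ r, lcsIn f S r = ⊥) ∧ normalizer f S = (S : Set L)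

/-- `U` is a subnormal subalgebra of `L`. -/
def IsSubnormal (f : AlternatingMap F L L (Fin (n + 2))) (U : Submodule F L) : Prop :=
  ∃ (r : ℕ) (C : ℕ → Submodule F L), C 0 = U ∧ C r = ⊤ ∧
    (∀ i ≤ r, IsSubalg f (C i)) ∧ ∀ i < r, IsIdealIn f (C i) (C (i + 1))

/-- An `A`-inner automorphism: a finite product of maps `1 + D(a,x₂,…,x_{n+1})`,
`a ∈ A`, where `A` is an abelian embedded ideal. -/
def IsAInner (f : AlternatingMap F L L (Fin (n + 2))) (A : Submodule F L)
    (α : L →ₗ[F] L) : Prop :=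
  ∃ (m : ℕ) (g : Fin m → (L →ₗ[F] L)),
    (∀ j, ∃ (a : L) (x : Fin n → L), a ∈ A ∧ g j = LinearMap.id + D f (Fin.cons a x)) ∧
    α = (List.ofFn g).prod

theorem IsIdeal.map_mem {f : AlternatingMap F L L (Fin (n + 2))} {A : Submodule F L}
    (hA : IsIdeal f A) {v : Fin (n + 2) → L} {i : Fin (n + 2)} (hi : v i ∈ A) : f v ∈ A := by
  have h : f (v ∘ Equiv.swap 0 i) ∈ A := hA _ (by simpa using hi)
  rw [f.map_perm] at h
  rcases Int.units_eq_one_or (Equiv.Perm.sign (Equiv.swap 0 i)) with hs | hs <;>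
    simpa [hs] using h

theorem IsAbelianEmbedded.map_eq_zero {f : AlternatingMap F L L (Fin (n + 2))}
    {A : Submodule F L} (hA : IsAbelianEmbedded f A) {v : Fin (n + 2) → L} {i j : Fin (n + 2)}
    (hij : i ≠ j) (hi : v i ∈ A) (hj : v j ∈ A) : f v = 0 := by
  obtain ⟨σ, h0, h1⟩ : ∃ σ : Equiv.Perm (Fin (n + 2)), σ 0 = i ∧ σ 1 = j := by
    refine ⟨(Equiv.swap 0 i).trans (Equiv.swap (Equiv.swap 0 i 1) j), ?_, ?_⟩
    · have hne : i ≠ Equiv.swap 0 i 1 := by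
        intro h
        have := congrArg (Equiv.swap 0 i) h
        simp at this
      simp [Equiv.swap_apply_of_ne_of_ne hne hij]
    · simp
  have h : f (v ∘ σ) = 0 := hA _ (by simpa [h0] using hi) (by simpa [h1] using hj)
  rw [f.map_perm] at h
  rcases Int.units_eq_one_or (Equiv.Perm.sign σ) with hs | hs <;> simpa [hs] using h

theorem D_cons_mem {f : AlternatingMap F L L (Fin (n + 2))} {A : Submodule F L}
    (hA : IsIdeal f A) {a : L} (ha : a ∈ A) (x : Fin n → L) (v : L) :
    D f (Fin.cons a x) v ∈ A := by
  refine hA _ ?_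
  rw [← Fin.castSucc_zero, Fin.snoc_castSucc]
  exact ha

theorem map_cons_cons_eq_zero {f : AlternatingMap F L L (Fin (n + 2))} {a v : L} {x : Fin n → L}
    (h : D f (Fin.cons a x) v = 0) : f (Fin.cons v (Fin.cons a x)) = 0 := by
  change f (Fin.snoc (Fin.cons a x : Fin (n + 1) → L) v) = 0 at h
  rw [Fin.snoc_eq_cons_rotate] at h
  have hrot : f (Fin.cons v (Fin.cons a x) ∘ finRotate (n + 2)) = 0 := h
  rw [f.map_perm] at hrot
  rcases Int.units_eq_one_or (Equiv.Perm.sign (finRotate (n + 2))) with hs | hs <;>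
    simpa [hs] using hrot

/-- If a derivation maps into an abelian embedded ideal, then `1 + d` preserves the bracket. -/
theorem IsDerivation.id_add_apply_map {f : AlternatingMap F L L (Fin (n + 2))}
    {A : Submodule F L} (hA : IsAbelianEmbedded f A) {d : L →ₗ[F] L} (hd : IsDerivation f d)
    (hdA : ∀ v, d v ∈ A) (v : Fin (n + 2) → L) :
    (LinearMap.id + d : L →ₗ[F] L) (f v) = f fun i => (LinearMap.id + d : L →ₗ[F] L) (v i) := by
  have h := f.toMultilinearMap.map_add_eq_map_add_linearDeriv_add v fun i => d (v i)
  rw [Finset.sum_eq_zero, add_zero, MultilinearMap.linearDeriv_apply] at h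
  · exact (congrArg (f v + ·) (hd v)).trans h.symm
  · intro s hs
    obtain ⟨i, hi, j, hj, hij⟩ := Finset.one_lt_card.mp (Finset.mem_filter.mp hs).2
    exact hA.map_eq_zero hij (by simpa [hi] using hdA _) (by simpa [hj] using hdA _)

/-- If a derivation maps into an abelian embedded ideal `A`, then `1 + d` maps complements to `A`
to complements to `A`. -/
theorem IsDerivation.isCompl_map_id_add {f : AlternatingMap F L L (Fin (n + 2))}
    {A : Submodule F L} (hA : IsAbelianEmbedded f A) {d : L →ₗ[F] L} (hd : IsDerivation f d)
    (hdA : ∀ v, d v ∈ A) {U : Submodule F L} (hU : IsSubalg f U) (hU1 : U ⊔ A = ⊤)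
    (hU2 : U ⊓ A = ⊥) :
    IsSubalg f (U.map (LinearMap.id + d)) ∧ U.map (LinearMap.id + d) ⊔ A = ⊤ ∧
      U.map (LinearMap.id + d) ⊓ A = ⊥ := by
  refine ⟨?_, ?_, ?_⟩
  · intro a ha
    choose b hb hba using ha
    refine ⟨f b, hU b hb, ?_⟩
    rw [hd.id_add_apply_map hA hdA]
    exact congrArg f (funext hba)
  · rw [eq_top_iff, ← hU1]
    refine sup_le (fun v hv => ?_) le_sup_right
    exact Submodule.mem_sup.mpr ⟨_, Submodule.mem_map_of_mem hv, -d v, A.neg_mem (hdA v), by simp⟩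
  · rw [eq_bot_iff]
    rintro _ ⟨⟨v, hv, rfl⟩, hvA⟩
    have hv0 : v ∈ U ⊓ A := ⟨hv, by simpa using A.sub_mem hvA (hdA v)⟩
    rw [hU2, Submodule.mem_bot] at hv0
    simp [hv0]

/-- If `u` lies in a complement `U` to `A` and in its image under `1 + d`, where `d` maps into `A`,
then `d u = 0`. -/
theorem apply_eq_zero_of_mem_map_id_add {A U : Submodule F L} (hU2 : U ⊓ A = ⊥) {d : L →ₗ[F] L}
    (hdA : ∀ v, d v ∈ A) {u : L} (hu : u ∈ U) (h : u ∈ U.map (LinearMap.id + d)) : d u = 0 := by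
  obtain ⟨v, hv, hvu⟩ := h
  have hdv : u - v = d v := by simp [← hvu]
  have hmem : u - v ∈ U ⊓ A := ⟨U.sub_mem hu hv, hdv ▸ hdA v⟩
  rw [hU2, Submodule.mem_bot] at hmem
  rw [sub_eq_zero.mp hmem, ← hdv, hmem]

/-- A nonzero element of a complement to a self-centralizing ideal `A` is moved off that complement
by some `1 + D(a, x)` with `a ∈ A`. -/
theorem exists_notMem_map_id_add_D {f : AlternatingMap F L L (Fin (n + 2))}
    {A U : Submodule F L} (hA : IsIdeal f A) (hC : centralizer f A ⊆ A) (hU2 : U ⊓ A = ⊥)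
    {u : L} (hu : u ∈ U) (hu0 : u ≠ 0) :
    ∃ a ∈ A, ∃ x : Fin n → L, u ∉ U.map (LinearMap.id + D f (Fin.cons a x)) := by
  by_contra! h
  have huA : u ∈ A := hC fun a ha x => map_cons_cons_eq_zero <|
    apply_eq_zero_of_mem_map_id_add hU2 (D_cons_mem hA ha x) hu (h a ha x)
  have hmem : u ∈ U ⊓ A := ⟨hu, huA⟩
  rw [hU2, Submodule.mem_bot] at hmem
  exact hu0 hmem

/-- In a finite-dimensional 2-soluble `n`-Lie algebra `L` with minimal
abelian embedded ideal `A` satisfying `C_L(A) = A`, for every complement `U` to `A` and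
every nonzero `u ∈ U` there is an `A`-inner automorphism `θ` with `u ∉ θ(U)`; in
particular the intersection of all complements to `A` in `L` is zero. -/
theorem stmt13 {F : Type*} [Field F] {L : Type*} [AddCommGroup L] [Module F L]
    [FiniteDimensional F L] {n : ℕ} (f : AlternatingMap F L L (Fin (n + 2)))
    (hf : IsNLie f) (hsol : Is2Soluble f)
    (A : Submodule F L) (hA : IsMinAbelianEmbeddedIdeal f A)
    (hC : centralizer f A = (A : Set L))
    (U : Submodule F L) (hU : IsSubalg f U) (hU1 : U ⊔ A = ⊤) (hU2 : U ⊓ A = ⊥) :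
    (∀ u ∈ U, u ≠ 0 →
      ∃ θ : L →ₗ[F] L, IsAInner f A θ ∧ u ∉ Submodule.map θ U) ∧
    sInf {V : Submodule F L | IsSubalg f V ∧ V ⊔ A = ⊤ ∧ V ⊓ A = ⊥} = ⊥ := by
  obtain ⟨-, hideal, habel, -⟩ := hA
  refine ⟨fun u hu hu0 => ?_, ?_⟩
  · obtain ⟨a, ha, x, hux⟩ := exists_notMem_map_id_add_D hideal hC.subset hU2 hu hu0
    exact ⟨_, ⟨1, fun _ => _, fun _ => ⟨a, x, ha, rfl⟩, by simp⟩, hux⟩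
  · rw [eq_bot_iff]
    intro u hu
    rw [Submodule.mem_sInf] at hu
    by_contra hu0
    obtain ⟨a, ha, x, hux⟩ :=
      exists_notMem_map_id_add_D hideal hC.subset hU2 (hu U ⟨hU, hU1, hU2⟩) hu0
    have hd : IsDerivation f (D f (Fin.cons a x)) := hf (Fin.cons a x)
    exact hux (hu _ (hd.isCompl_map_id_add habel (D_cons_mem hideal ha x) hU hU1 hU2))

end NLie
end

section
/- Let L be a finite-dimensional n-Lie algebra, let K be an ideal of L, and let S be a Cartan subalgebra of K. Then L = K + N_L(S). -/
namespace NLie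

open Finset

variable {F : Type*} [Field F] {L : Type*} [AddCommGroup L] [Module F L] {n : ℕ}

attribute [local instance] LieRing.ofAssociativeRing

/-- A tuple with a last entry `x` is, up to sign, the tuple with `x` moved to the front. -/
lemma map_snoc_eq_sign_smul_map_cons (f : AlternatingMap F L L (Fin (n + 2)))
    (a : Fin (n + 1) → L) (x : L) :
    f (Fin.snoc a x) = Equiv.Perm.sign (finRotate (n + 2)) • f (Fin.cons x a) := by
  rw [← f.map_perm, Fin.snoc_eq_cons_rotate]
  rfl

lemma map_snoc_mem_iff (f : AlternatingMap F L L (Fin (n + 2))) (U : Submodule F L)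
    (a : Fin (n + 1) → L) (x : L) :
    f (Fin.snoc a x) ∈ U ↔ f (Fin.cons x a) ∈ U := by
  rw [map_snoc_eq_sign_smul_map_cons]
  rcases Int.units_eq_one_or (Equiv.Perm.sign (finRotate (n + 2))) with h | h <;> simp [h]

lemma D_apply (f : AlternatingMap F L L (Fin (n + 2))) (a : Fin (n + 1) → L) (x : L) :
    D f a x = f (Fin.snoc a x) := rfl

lemma D_eq_zero_of_apply_eq_zero (f : AlternatingMap F L L (Fin (n + 2)))
    (a : Fin (n + 1) → L) (i : Fin (n + 1)) (h : a i = 0) : D f a = 0 := by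
  ext x
  exact f.map_coord_zero i.castSucc (by simpa using h)

/-- The commutator of two inner derivations is a sum of inner derivations. -/
lemma lie_D_D {f : AlternatingMap F L L (Fin (n + 2))} (hf : IsNLie f)
    (a b : Fin (n + 1) → L) :
    ⁅D f a, D f b⁆ = ∑ i, D f (Function.update b i (D f a (b i))) := by
  ext x
  have h := hf a (Fin.snoc b x)
  rw [Fin.sum_univ_castSucc] at h
  simp only [Fin.snoc_castSucc, Fin.snoc_last, Fin.update_snoc_last, ← Fin.snoc_update] at h
  simp only [Ring.lie_def, LinearMap.sub_apply,
    Module.End.mul_apply, LinearMap.sum_apply, D_apply, h, add_sub_cancel_right]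

lemma IsIdeal.D_apply_mem {f : AlternatingMap F L L (Fin (n + 2))} {K : Submodule F L}
    (hK : IsIdeal f K) (a : Fin (n + 1) → L) {x : L} (hx : x ∈ K) : D f a x ∈ K :=
  (map_snoc_mem_iff f K a x).2 (hK _ (by simpa using hx))

lemma IsIdeal.D_apply_mem_of_mem {f : AlternatingMap F L L (Fin (n + 2))} {K : Submodule F L}
    (hK : IsIdeal f K) {a : Fin (n + 1) → L} (ha : a 0 ∈ K) (x : L) : D f a x ∈ K :=
  hK _ ((Fin.snoc_castSucc (α := fun _ => L) x a 0).symm ▸ ha)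

/-- An element of `D(U)` maps into `V` all elements that the generators of `D(U)` map into `V`. -/
lemma apply_mem_of_mem_Dspan {f : AlternatingMap F L L (Fin (n + 2))} {U V : Submodule F L} {x : L}
    (h : ∀ a : Fin (n + 1) → L, (∀ i, a i ∈ U) → D f a x ∈ V) {d : L →ₗ[F] L}
    (hd : d ∈ Dspan f U) : d x ∈ V := by
  have : Dspan f U ≤ V.comap (LinearMap.applyₗ x) := by
    refine Submodule.span_le.2 ?_
    rintro _ ⟨a, ha, rfl⟩
    exact h a ha
  exact this hd

lemma D_apply_mem_lcsIn_succ (f : AlternatingMap F L L (Fin (n + 2))) (S : Submodule F L)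
    {a : Fin (n + 1) → L} (ha : ∀ i, a i ∈ S) {k : ℕ} {x : L} (hx : x ∈ lcsIn f S k) :
    D f a x ∈ lcsIn f S (k + 1) := by
  refine (map_snoc_mem_iff f _ a x).2 (Submodule.subset_span ⟨_, fun i => ?_, rfl⟩)
  cases i using Fin.cases with
  | zero => simpa using hx
  | succ i => simpa using ha i

lemma bracketSpan_mono (f : AlternatingMap F L L (Fin (n + 2)))
    {A B : Fin (n + 2) → Submodule F L} (h : ∀ i, A i ≤ B i) :
    bracketSpan f A ≤ bracketSpan f B :=
  Submodule.span_mono fun _ ⟨a, ha, hz⟩ => ⟨a, fun i => h i (ha i), hz⟩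

lemma lcsIn_antitone {f : AlternatingMap F L L (Fin (n + 2))} {S : Submodule F L}
    (hS : IsSubalg f S) : Antitone (lcsIn f S) := by
  refine antitone_nat_of_succ_le fun k => ?_
  induction k with
  | zero =>
    refine Submodule.span_le.2 ?_
    rintro _ ⟨a, ha, rfl⟩
    refine hS a fun i => ?_
    cases i using Fin.cases with
    | zero => exact ha 0
    | succ i => exact ha i.succ
  | succ k ih =>
    refine bracketSpan_mono f fun i => ?_
    cases i using Fin.cases with
    | zero => exact ih
    | succ i => exact le_rfl

/-- The span of all `D(a₁,…,a_{n+1})` with the `aᵢ` in terms of the lower central series of `S`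
whose indices add up to at least `m`. -/
def DspanFiltration (f : AlternatingMap F L L (Fin (n + 2))) (S : Submodule F L) (m : ℕ) :
    Submodule F (L →ₗ[F] L) :=
  Submodule.span F {d | ∃ (a : Fin (n + 1) → L) (k : Fin (n + 1) → ℕ),
    (∀ i, a i ∈ lcsIn f S (k i)) ∧ m ≤ ∑ i, k i ∧ d = D f a}

lemma Dspan_le_DspanFiltration_zero (f : AlternatingMap F L L (Fin (n + 2)))
    (S : Submodule F L) : Dspan f S ≤ DspanFiltration f S 0 :=
  Submodule.span_mono fun _ ⟨a, ha, hd⟩ => ⟨a, 0, ha, Nat.zero_le _, hd⟩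

lemma DspanFiltration_le_Dspan {f : AlternatingMap F L L (Fin (n + 2))} {S : Submodule F L}
    (hS : IsSubalg f S) (m : ℕ) : DspanFiltration f S m ≤ Dspan f S :=
  Submodule.span_mono fun _ ⟨a, k, ha, _, hd⟩ =>
    ⟨a, fun i => lcsIn_antitone hS (Nat.zero_le (k i)) (ha i), hd⟩

lemma lie_mem_DspanFiltration_succ {f : AlternatingMap F L L (Fin (n + 2))} (hf : IsNLie f)
    {S : Submodule F L} {m : ℕ} {d e : Module.End F L} (hd : d ∈ Dspan f S)
    (he : e ∈ DspanFiltration f S m) : ⁅d, e⁆ ∈ DspanFiltration f S (m + 1) := by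
  induction hd using Submodule.span_induction with
  | zero => simp
  | add x y _ _ hx hy => rw [add_lie]; exact add_mem hx hy
  | smul c x _ hx => rw [smul_lie]; exact Submodule.smul_mem _ c hx
  | mem d hd =>
    obtain ⟨a, ha, rfl⟩ := hd
    induction he using Submodule.span_induction with
    | zero => simp
    | add x y _ _ hx hy => rw [lie_add]; exact add_mem hx hy
    | smul c x _ hx => rw [lie_smul]; exact Submodule.smul_mem _ c hx
    | mem e he =>
      obtain ⟨b, k, hb, hk, rfl⟩ := he
      rw [lie_D_D hf]
      refine Submodule.sum_mem _ fun i _ =>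
        Submodule.subset_span ⟨_, Function.update k i (k i + 1), fun j => ?_, ?_, rfl⟩
      · rcases eq_or_ne j i with rfl | hj
        · simpa using D_apply_mem_lcsIn_succ f S ha (hb j)
        · simpa [hj] using hb j
      · rw [Finset.sum_update_of_mem (Finset.mem_univ i)]
        rw [← Finset.add_sum_erase _ _ (Finset.mem_univ i), ← Finset.sdiff_singleton_eq_erase]
          at hk
        omega

lemma DspanFiltration_eq_bot {f : AlternatingMap F L L (Fin (n + 2))} {S : Submodule F L}
    (hS : IsSubalg f S) {r : ℕ} (hr : lcsIn f S r = ⊥) :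
    DspanFiltration f S ((n + 1) * r + 1) = ⊥ := by
  refine eq_bot_iff.2 (Submodule.span_le.2 ?_)
  rintro _ ⟨a, k, ha, hk, rfl⟩
  obtain ⟨i, hi⟩ : ∃ i, r ≤ k i := by
    by_contra! h
    have := Finset.sum_le_sum fun i (_ : i ∈ Finset.univ) => (h i).le
    simp at this
    omega
  refine D_eq_zero_of_apply_eq_zero f a i ?_
  simpa [hr] using lcsIn_antitone hS hi (ha i)

/-- `D(S)` as a Lie algebra of endomorphisms of `L`. -/
def DLieSubalgebra (f : AlternatingMap F L L (Fin (n + 2))) (hf : IsNLie f)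
    (S : Submodule F L) (hS : IsSubalg f S) : LieSubalgebra F (Module.End F L) where
  __ := Dspan f S
  lie_mem' hd he := DspanFiltration_le_Dspan hS _
    (lie_mem_DspanFiltration_succ hf hd (Dspan_le_DspanFiltration_zero f S he))

lemma isNilpotent_DLieSubalgebra {f : AlternatingMap F L L (Fin (n + 2))} (hf : IsNLie f)
    {S : Submodule F L} (hS : IsSubalg f S) (hSnil : ∃ r, lcsIn f S r = ⊥) :
    LieRing.IsNilpotent (DLieSubalgebra f hf S hS) := by
  obtain ⟨r, hr⟩ := hSnil
  set H := DLieSubalgebra f hf S hS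
  have key (m : ℕ) : (LieModule.lowerCentralSeries F H H m).toSubmodule ≤
      (DspanFiltration f S m).comap H.toSubmodule.subtype := by
    induction m with
    | zero => exact fun x _ => Dspan_le_DspanFiltration_zero f S x.2
    | succ m ih =>
      rw [LieModule.lowerCentralSeries_succ, LieSubmodule.lieIdeal_oper_eq_linear_span',
        Submodule.span_le]
      rintro _ ⟨d, -, e, he, rfl⟩
      exact lie_mem_DspanFiltration_succ hf d.2 (ih he)
  rw [LieRing.IsNilpotent, LieModule.isNilpotent_iff F]
  refine ⟨(n + 1) * r + 1, eq_bot_iff.2 fun x hx => ?_⟩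
  have := key _ hx
  rw [DspanFiltration_eq_bot hS hr] at this
  simpa using this

/-- Let `K` be an ideal of `L` and `S` a Cartan subalgebra of `K`
(i.e. a nilpotent subalgebra `S ≤ K` with `N_K(S) = S`).  Then `L = K + N_L(S)`. -/
theorem stmt17 {F : Type*} [Field F] {L : Type*} [AddCommGroup L] [Module F L]
    [FiniteDimensional F L] {n : ℕ} (f : AlternatingMap F L L (Fin (n + 2)))
    (hf : IsNLie f) (K S : Submodule F L)
    (hK : IsIdeal f K) (hSK : S ≤ K) (hS : IsSubalg f S)
    (hSnil : ∃ r, lcsIn f S r = ⊥)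
    (hN : (K : Set L) ∩ normalizer f S = (S : Set L)) :
    ∀ x : L, ∃ k ∈ K, ∃ y ∈ normalizer f S, x = k + y := by
  have := isNilpotent_DLieSubalgebra hf hS hSnil
  set H := DLieSubalgebra f hf S hS
  let K' : LieSubmodule F H L :=
    { K with
      lie_mem := fun {d _} hx =>
        apply_mem_of_mem_Dspan (V := K) (fun a _ => hK.D_apply_mem a hx) d.2 }
  set L₀ := LieModule.genWeightSpace L (0 : H → F)
  have hle : LieModule.posFittingComp F H L ≤ K' := by
    refine (LieModule.posFittingComp_le_iInf_lowerCentralSeries F H L).trans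
      ((iInf_le _ 1).trans ?_)
    rw [LieModule.lowerCentralSeries_succ, LieSubmodule.lie_le_iff]
    exact fun d _ x _ => apply_mem_of_mem_Dspan
      (fun a ha => hK.D_apply_mem_of_mem (hSK (ha 0)) x) d.2
  have hL₀ : ∀ x ∈ K' ⊓ L₀, x ∈ S := by
    obtain ⟨k, hk⟩ := LieModule.IsNilpotent.nilpotent F H L₀
    rw [LieSubmodule.lowerCentralSeries_eq_bot_iff_lcs_eq_bot] at hk
    suffices h : ∀ j ≤ k, ∀ x ∈ K' ⊓ L₀.lcs j, x ∈ S from h 0 (Nat.zero_le k)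
    intro j hj
    induction hj using Nat.decreasingInduction with
    | self =>
      intro x hx
      rw [hk, inf_bot_eq, LieSubmodule.mem_bot] at hx
      exact hx ▸ S.zero_mem
    | of_succ j _ ih =>
      rintro x ⟨hxK, hxL⟩
      refine hN.subset ⟨hxK, fun u hu => (map_snoc_mem_iff f S u x).1 (ih _ ?_)⟩
      refine ⟨hK.D_apply_mem u hxK, ?_⟩
      let d : H := ⟨D f u, Submodule.subset_span ⟨u, hu, rfl⟩⟩
      rw [LieSubmodule.lcs_succ]
      exact LieSubmodule.lie_mem_lie (LieSubmodule.mem_top d) hxL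
  intro x
  have hx : x ∈ L₀ ⊔ LieModule.posFittingComp F H L := by
    rw [(LieModule.isCompl_genWeightSpace_zero_posFittingComp F H L).sup_eq_top]
    exact LieSubmodule.mem_top x
  obtain ⟨y, hy, k, hk, rfl⟩ := (LieSubmodule.mem_sup _ _ _).1 hx
  refine ⟨k, hle hk, y, fun u hu => (map_snoc_mem_iff f S u y).1 (hL₀ _ ⟨?_, ?_⟩), add_comm y k⟩
  · exact hK.D_apply_mem_of_mem (hSK (hu 0)) y
  · let d : H := ⟨D f u, Submodule.subset_span ⟨u, hu, rfl⟩⟩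
    exact L₀.lie_mem (x := d) hy

end NLie
end
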